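/- Let d ≥ 2 and let b_1 < b_2 < ⋯ < b_d be integers with b_1 > 1. For any integers r, k ≥ 1, there exist integers c_2, …, c_d with 1 ≤ c_2 ≤ b_1^{k(d−2)} and 0 ≤ c_j ≤ c_2 for 3 ≤ j ≤ d, such that b_d^{−r}·b_2^{r·c_2·b_1^k} ≤ b_j^{r·c_j·b_1^k} ≤ b_d^{r}·b_2^{r·c_2·b_1^k} holds for all 2 ≤ j ≤ d. -/

import Mathlib

/-- Simultaneous Dirichlet approximation of reals in `[0, 1]`, with numerators bounded by the
common denominator. -/
theorem exists_simultaneous_approx {ι : Type*} [Fintype ι] (α : ι → ℝ)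
    (h0 : ∀ i, 0 ≤ α i) (h1 : ∀ i, α i ≤ 1) {N : ℕ} (hN : 0 < N) :
    ∃ q : ℕ, 1 ≤ q ∧ q ≤ N ^ Fintype.card ι ∧
      ∃ p : ι → ℕ, ∀ i, p i ≤ q ∧ |q * α i - p i| * N ≤ 1 := by
  classical
  have hN' : (0 : ℝ) < N := by exact_mod_cast hN
  have hbox : ∀ x : ℝ, ⌊Int.fract x * N⌋₊ < N := fun x => by
    rw [Nat.floor_lt (by positivity)]
    nlinarith [Int.fract_lt_one x]
  let box : Fin (N ^ Fintype.card ι + 1) → ι → Fin N :=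
    fun q i => ⟨⌊Int.fract ((q : ℕ) * α i) * N⌋₊, hbox _⟩
  obtain ⟨x, y, hxy, hbox_eq⟩ :=
    Fintype.exists_ne_map_eq_of_card_lt box (by simp)
  wlog hlt : x < y generalizing x y
  · exact this y x hxy.symm hbox_eq.symm (lt_of_le_of_ne (not_lt.mp hlt) hxy.symm)
  have hlt' : (x : ℕ) < y := hlt
  have hcast : ((y - x : ℕ) : ℝ) = (y : ℕ) - (x : ℕ) := Nat.cast_sub hlt'.le
  have hpos : (0 : ℝ) ≤ (y : ℕ) - (x : ℕ) := by rw [← hcast]; positivity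
  refine ⟨y - x, by omega, by omega,
    fun i => (⌊(y : ℕ) * α i⌋ - ⌊(x : ℕ) * α i⌋).toNat, fun i => ?_⟩
  have hmono : ⌊(x : ℕ) * α i⌋ ≤ ⌊(y : ℕ) * α i⌋ :=
    Int.floor_le_floor (by nlinarith [h0 i])
  have hupper : ⌊(y : ℕ) * α i⌋ ≤ ⌊(x : ℕ) * α i⌋ + ((y - x : ℕ) : ℤ) := by
    rw [← Int.floor_add_intCast]
    apply Int.floor_le_floor
    rw [Int.cast_natCast, hcast]
    nlinarith [h1 i]
  refine ⟨by dsimp only; omega, ?_⟩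
  have hp : (((⌊(y : ℕ) * α i⌋ - ⌊(x : ℕ) * α i⌋).toNat : ℕ) : ℝ)
      = ⌊(y : ℕ) * α i⌋ - ⌊(x : ℕ) * α i⌋ := by
    rw [← Int.cast_natCast, Int.toNat_of_nonneg (by omega), Int.cast_sub]
  have hfloor : ⌊Int.fract ((x : ℕ) * α i) * N⌋₊ = ⌊Int.fract ((y : ℕ) * α i) * N⌋₊ :=
    congrArg Fin.val (congrFun hbox_eq i)
  have hx0 : 0 ≤ Int.fract ((x : ℕ) * α i) * N := by positivity
  have hy0 : 0 ≤ Int.fract ((y : ℕ) * α i) * N := by positivity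
  have hx1 := Nat.floor_le hx0
  have hx2 := Nat.lt_floor_add_one (Int.fract ((x : ℕ) * α i) * N)
  have hy1 := Nat.floor_le hy0
  have hy2 := Nat.lt_floor_add_one (Int.fract ((y : ℕ) * α i) * N)
  rw [hfloor] at hx1 hx2
  rw [hp, hcast, ← abs_of_pos hN', ← abs_mul, abs_le]
  have hdiff : (((y : ℕ) - (x : ℕ) : ℝ) * α i - (⌊(y : ℕ) * α i⌋ - ⌊(x : ℕ) * α i⌋)) * N
      = Int.fract ((y : ℕ) * α i) * N - Int.fract ((x : ℕ) * α i) * N := by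
    unfold Int.fract
    ring
  rw [hdiff]
  constructor <;> linarith

/-- Exponentiated form of `|m log A - n log B| * N ≤ log L`. -/
theorem pow_le_pow_of_abs_log_sub_le {A B L : ℝ} (hA : 0 < A) (hB : 0 < B) (hL : 0 < L)
    (r m n N : ℕ) (h : |m * Real.log A - n * Real.log B| * N ≤ Real.log L) :
    A ^ (r * m * N) / L ^ r ≤ B ^ (r * n * N) ∧
      B ^ (r * n * N) ≤ L ^ r * A ^ (r * m * N) := by
  have hr : (0 : ℝ) ≤ r := Nat.cast_nonneg r
  have hN : (0 : ℝ) ≤ N := Nat.cast_nonneg N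
  rw [← abs_of_nonneg hN, ← abs_mul, abs_le] at h
  have hl := mul_le_mul_of_nonneg_left h.1 hr
  have hu := mul_le_mul_of_nonneg_left h.2 hr
  constructor
  · rw [← Real.log_le_log_iff (by positivity) (by positivity),
      Real.log_div (by positivity) (by positivity)]
    simp only [Real.log_pow]
    push_cast
    linarith
  · rw [← Real.log_le_log_iff (by positivity) (by positivity),
      Real.log_mul (by positivity) (by positivity)]
    simp only [Real.log_pow]
    push_cast
    linarith


/-- Proposition 2.4: simultaneous Dirichlet approximation. For integers
`1 < b 0 < ⋯ < b (d-1)` and `r, k ≥ 1`, there exist `c_2, …, c_d` with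
`1 ≤ c_2 ≤ b_1^{k(d-2)}` and `0 ≤ c_j ≤ c_2` such that
`b_d^{-r} b_2^{r c_2 b_1^k} ≤ b_j^{r c_j b_1^k} ≤ b_d^{r} b_2^{r c_2 b_1^k}` for `2 ≤ j ≤ d`. -/
theorem exists_balanced_exponents
    (d : ℕ) (hd : 2 ≤ d) [NeZero d] (b : Fin d → ℕ)
    (hb1 : 1 < b 0) (hmono : StrictMono b)
    (r k : ℕ) (hr : 1 ≤ r) (hk : 1 ≤ k) :
    ∃ c : Fin d → ℕ,
      1 ≤ c 1 ∧ c 1 ≤ b 0 ^ (k * (d - 2)) ∧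
      (∀ j : Fin d, 2 ≤ (j : ℕ) → c j ≤ c 1) ∧
      ∀ j : Fin d, 1 ≤ (j : ℕ) →
        (b 1 : ℝ) ^ (r * c 1 * b 0 ^ k) / (b ⟨d - 1, by omega⟩ : ℝ) ^ r
            ≤ (b j : ℝ) ^ (r * c j * b 0 ^ k) ∧
        (b j : ℝ) ^ (r * c j * b 0 ^ k)
            ≤ (b ⟨d - 1, by omega⟩ : ℝ) ^ r * (b 1 : ℝ) ^ (r * c 1 * b 0 ^ k) := by
  have hone : ((1 : Fin d) : ℕ) = 1 := by
    rw [Fin.val_one', Nat.mod_eq_of_lt hd]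
  have hb : ∀ j, 1 < b j := fun j => hb1.trans_le (hmono.monotone (Fin.zero_le j))
  have hbpos : ∀ j, (0 : ℝ) < b j := fun j => by exact_mod_cast zero_lt_one.trans (hb j)
  have hlog : ∀ j, 0 < Real.log (b j) := fun j => Real.log_pos (by exact_mod_cast hb j)
  have hlogmono : ∀ i j, i ≤ j → Real.log (b i) ≤ Real.log (b j) := fun i j hij =>
    Real.log_le_log (hbpos i) (by exact_mod_cast hmono.monotone hij)
  obtain ⟨q, hq1, hq2, p, hp⟩ := exists_simultaneous_approx
    (fun i : Fin (d - 2) =>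
      Real.log (b 1) / Real.log (b ⟨i + 2, by omega⟩))
    (fun i => div_nonneg (hlog _).le (hlog _).le)
    (fun i => (div_le_one (hlog _)).2 (hlogmono _ _ (by
      rw [Fin.le_def, hone]; change 1 ≤ (i : ℕ) + 2; omega)))
    (N := b 0 ^ k) (by positivity)
  rw [Fintype.card_fin, ← pow_mul] at hq2
  let c : Fin d → ℕ := fun j => if h : 2 ≤ (j : ℕ) then p ⟨j - 2, by omega⟩ else q
  have hc1 : c 1 = q := dif_neg (by omega)
  refine ⟨c, by rwa [hc1], by rwa [hc1], fun j hj => ?_, fun j hj => ?_⟩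
  · rw [hc1]
    simpa only [c, dif_pos hj] using (hp _).1
  · apply pow_le_pow_of_abs_log_sub_le (hbpos _) (hbpos _) (hbpos _)
    rw [hc1]
    by_cases h : 2 ≤ (j : ℕ)
    · have hcj : c j = p ⟨j - 2, by omega⟩ := dif_pos h
      have hidx : (⟨(j : ℕ) - 2 + 2, by omega⟩ : Fin d) = j := Fin.ext (by simp; omega)
      have happ := (hp ⟨j - 2, by omega⟩).2
      simp only [hidx] at happ
      have hfactor : (q : ℝ) * Real.log (b 1) - c j * Real.log (b j)
          = (q * (Real.log (b 1) / Real.log (b j)) - c j) * Real.log (b j) := by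
        have := (hlog j).ne'
        field_simp
      rw [hfactor, abs_mul, abs_of_pos (hlog j), hcj, mul_right_comm]
      calc _ ≤ 1 * Real.log (b j) := mul_le_mul_of_nonneg_right happ (hlog j).le
        _ ≤ _ := by
          rw [one_mul]
          exact hlogmono _ _ (by rw [Fin.le_def]; change (j : ℕ) ≤ d - 1; omega)
    · have hj1 : j = 1 := Fin.ext (by omega)
      rw [hj1, hc1, sub_self, abs_zero, zero_mul]
      exact (hlog _).le
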